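/- Let u_1, u_2, u_3 be nowhere vanishing holomorphic functions on an open set U ⊂ C^m, h a holomorphic function on U, and p_0 a positive integer. Set F_i := h^{p_0} u_i. Then the Cartan auxiliary function satisfies Φ^1(F_1,F_2,F_3) = u_1·(u_3 ∂_{z_1}u_2 − u_2 ∂_{z_1}u_3)·h^{p_0}/(u_2 u_3) + u_2·(u_1 ∂_{z_1}u_3 − u_3 ∂_{z_1}u_1)·h^{p_0}/(u_3 u_1) + u_3·(u_2 ∂_{z_1}u_1 − u_1 ∂_{z_1}u_2)·h^{p_0}/(u_1 u_2); in particular every zero of h of order 1 gives a zero of Φ^1(F_1,F_2,F_3) of order at least p_0. -/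

import Mathlib

/-- Partial derivative in the `l`-th coordinate direction. -/
noncomputable def pd {m : ℕ} (l : Fin m) (f : (Fin m → ℂ) → ℂ) (z : Fin m → ℂ) : ℂ :=
  fderiv ℂ f z (Pi.single l 1)

/-- The Cartan auxiliary function. -/
noncomputable def Phi {m : ℕ} (l : Fin m) (F G H : (Fin m → ℂ) → ℂ) (z : Fin m → ℂ) : ℂ :=
  F z * G z * H z *
    Matrix.det !![(1 : ℂ), 1, 1;
                  (F z)⁻¹, (G z)⁻¹, (H z)⁻¹;
                  pd l (fun w => (F w)⁻¹) z, pd l (fun w => (G w)⁻¹) z,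
                    pd l (fun w => (H w)⁻¹) z]

section Holomorphic

open Metric Set Filter Topology MeasureTheory Complex

variable {E F : Type*} [NormedAddCommGroup E] [NormedSpace ℂ E] [FiniteDimensional ℂ E]
  [NormedAddCommGroup F] [NormedSpace ℂ F] [CompleteSpace F] [SecondCountableTopology F]
  {f : E → F} {s : Set E}

/-- Directional derivatives of a holomorphic function of several variables are holomorphic. -/
theorem DifferentiableOn.fderiv_apply_of_isOpen (hf : DifferentiableOn ℂ f s) (hs : IsOpen s)
    (v : E) : DifferentiableOn ℂ (fun y ↦ fderiv ℂ f y v) s := by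
  intro x hx
  refine DifferentiableAt.differentiableWithinAt ?_
  obtain ⟨ε, hε, hball⟩ : ∃ ε > 0, ball x ε ⊆ s ∩ f ⁻¹' ball (f x) 1 :=
    Metric.mem_nhds_iff.1 <| inter_mem (hs.mem_nhds hx) <|
      (hf.differentiableAt (hs.mem_nhds hx)).continuousAt.preimage_mem_nhds
        (ball_mem_nhds _ one_pos)
  obtain ⟨r, hr, hrv⟩ : ∃ r > 0, r * ‖v‖ < ε / 4 := by
    refine ⟨ε / 4 / (‖v‖ + 1), by positivity, ?_⟩
    rw [div_mul_eq_mul_div, div_lt_iff₀ (by positivity)]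
    nlinarith [norm_nonneg v]
  have hmem {y : E} (hy : y ∈ ball x (ε / 4)) {ζ : ℂ} (hζ : ‖ζ‖ ≤ r) :
      y + ζ • v ∈ ball x (ε / 2) := by
    rw [mem_ball_iff_norm] at hy ⊢
    calc ‖y + ζ • v - x‖ = ‖(y - x) + ζ • v‖ := by congr 1; abel
      _ ≤ ‖y - x‖ + ‖ζ • v‖ := norm_add_le _ _
      _ ≤ ‖y - x‖ + r * ‖v‖ := by rw [norm_smul]; gcongr
      _ < ε / 2 := by linarith
  have hdiff {y : E} (hy : y ∈ ball x (ε / 2)) : DifferentiableAt ℂ f y :=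
    hf.differentiableAt (hs.mem_nhds (hball (ball_subset_ball (by linarith) hy)).1)
  have hbound {y : E} (hy : y ∈ ball x (ε / 2)) : ‖fderiv ℂ f y‖ ≤ 2 / (ε / 2) := by
    have hsub : ball y (ε / 2) ⊆ ball x ε :=
      ball_subset_ball' (by rw [mem_ball] at hy; linarith)
    refine norm_fderiv_le_div_of_mapsTo_ball
      (hf.mono fun z hz ↦ (hball (hsub hz)).1) (fun z hz ↦ ?_) (by positivity)
    have h₁ : Dist.dist (f z) (f x) < 1 := (hball (hsub hz)).2
    have h₂ : Dist.dist (f y) (f x) < 1 := (hball (hsub (mem_ball_self (by positivity)))).2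
    rw [mem_closedBall]
    linarith [dist_triangle_right (f z) (f y) (f x)]
  have hcircle (θ : ℝ) : ‖circleMap 0 r θ‖ ≤ r := by simp [abs_of_pos hr]
  let k : ℝ → ℂ := fun θ ↦ _root_.deriv (circleMap 0 r) θ * (1 / (circleMap 0 r θ) ^ 2)
  have hk : Continuous k := by
    have h0 (θ : ℝ) : circleMap 0 r θ ^ 2 ≠ 0 := pow_ne_zero _ (circleMap_ne_center hr.ne')
    simp only [k, deriv_circleMap]
    fun_prop (disch := exact h0 _)
  have hcont {y : E} (hy : y ∈ ball x (ε / 4)) :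
      Continuous fun θ ↦ k θ • f (y + circleMap 0 r θ • v) := by
    refine hk.smul (continuous_iff_continuousAt.2 fun θ ↦ ?_)
    exact ContinuousAt.comp (f := fun θ ↦ y + circleMap 0 r θ • v)
      (hdiff (hmem hy (hcircle θ))).continuousAt (by fun_prop)
  have hcauchy : (fun y ↦ fderiv ℂ f y v) =ᶠ[𝓝 x] fun y ↦ (2 * Real.pi * I : ℂ)⁻¹ •
      ∫ θ in Ioc 0 (2 * Real.pi), k θ • f (y + circleMap 0 r θ • v) := by
    filter_upwards [ball_mem_nhds x (show 0 < ε / 4 by positivity)] with y hy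
    have hline {ζ : ℂ} (hζ : ‖ζ‖ ≤ r) :
        HasDerivAt (fun ζ : ℂ ↦ f (y + ζ • v)) (fderiv ℂ f (y + ζ • v) v) ζ := by
      refine (hdiff (hmem hy hζ)).hasFDerivAt.comp_hasDerivAt ζ ?_
      simpa using ((hasDerivAt_id ζ).smul_const v).const_add y
    have hint := DifferentiableOn.deriv_eq_smul_circleIntegral (c := 0) hr
      (f := fun ζ : ℂ ↦ f (y + ζ • v)) fun ζ hζ ↦
        (hline (by simpa using hζ)).differentiableAt.differentiableWithinAt
    rw [(hline (by simpa using hr.le)).deriv, zero_smul, add_zero, circleIntegral,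
      intervalIntegral.integral_of_le (by positivity)] at hint
    rw [eq_inv_smul_iff₀ two_pi_I_ne_zero, ← hint]
    simp only [k, sub_zero, smul_smul]
  refine DifferentiableAt.congr_of_eventuallyEq (DifferentiableAt.const_smul ?_ _) hcauchy
  borelize E
  borelize (E →L[ℂ] F)
  refine (hasFDerivAt_integral_of_dominated_of_fderiv_le
    (F' := fun y θ ↦ k θ • fderiv ℂ f (y + circleMap 0 r θ • v))
    (bound := fun θ ↦ ‖k θ‖ * (2 / (ε / 2)))
    (ball_mem_nhds x (show 0 < ε / 4 by positivity)) ?_ ?_ ?_ ?_ ?_ ?_).differentiableAt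
  · filter_upwards [ball_mem_nhds x (show 0 < ε / 4 by positivity)] with y hy
    exact (hcont hy).aestronglyMeasurable
  · exact (hcont (mem_ball_self (by positivity))).integrableOn_Ioc
  · refine hk.aestronglyMeasurable.smul (Measurable.aestronglyMeasurable ?_)
    exact (measurable_fderiv ℂ f).comp (by fun_prop : Continuous _).measurable
  · refine Eventually.of_forall fun θ y hy ↦ ?_
    rw [norm_smul]
    gcongr
    exact hbound (hmem hy (hcircle θ))
  · exact Continuous.integrableOn_Ioc (by fun_prop)
  · refine Eventually.of_forall fun θ y hy ↦ ?_
    exact ((hasFDerivAt_comp_add_right _).2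
      (hdiff (hmem hy (hcircle θ))).hasFDerivAt).const_smul (k θ)

/-- Holomorphic functions of several variables are smooth. -/
theorem DifferentiableOn.contDiffOn_infty_of_isOpen (hf : DifferentiableOn ℂ f s)
    (hs : IsOpen s) : ContDiffOn ℂ (⊤ : ℕ∞) f s := by
  rw [contDiffOn_infty]
  intro n
  induction n generalizing f with
  | zero => exact contDiffOn_zero.2 hf.continuousOn
  | succ n ih =>
    rw [Nat.cast_succ, contDiffOn_succ_iff_fderiv_of_isOpen hs]
    exact ⟨hf, by simp, contDiffOn_clm_apply.2 fun v ↦ ih (hf.fderiv_apply_of_isOpen hs v)⟩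

end Holomorphic

/-- If `h` vanishes at `z`, all derivatives of `h ^ p * g` of order less than `p` vanish at `z`. -/
theorem iteratedFDerivWithin_pow_mul_eq_zero {𝕜 E A : Type*} [NontriviallyNormedField 𝕜]
    [NormedAddCommGroup E] [NormedSpace 𝕜 E] [NormedCommRing A] [NormedAlgebra 𝕜 A]
    {h g : E → A} {s : Set E} {z : E} (hs : UniqueDiffOn 𝕜 s)
    (hh : ContDiffOn 𝕜 (⊤ : ℕ∞) h s) (hg : ContDiffOn 𝕜 (⊤ : ℕ∞) g s) (hz : z ∈ s)
    (hhz : h z = 0) {p i : ℕ} (hi : i < p) :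
    iteratedFDerivWithin 𝕜 i (fun w ↦ h w ^ p * g w) s z = 0 := by
  induction p generalizing i with
  | zero => omega
  | succ p ih =>
    simp only [pow_succ', mul_assoc]
    rw [← norm_le_zero_iff]
    refine (norm_iteratedFDerivWithin_mul_le hh ((hh.pow p).mul hg) hs hz
      (by exact_mod_cast le_top)).trans (Finset.sum_nonpos fun j hji ↦ ?_)
    rcases Nat.eq_zero_or_pos j with rfl | hj
    · simp [hhz]
    · rw [ih (by rw [Finset.mem_range] at hji; omega), norm_zero, mul_zero]

section PartialDerivative

variable {m : ℕ} {l : Fin m} {f u v w h F G H : (Fin m → ℂ) → ℂ} {z : Fin m → ℂ}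

theorem pd_inv (hf : DifferentiableAt ℂ f z) (hz : f z ≠ 0) :
    pd l (fun w ↦ (f w)⁻¹) z = -pd l f z / f z ^ 2 := by
  simp only [pd]
  rw [show (fun w ↦ (f w)⁻¹) = (fun x ↦ x⁻¹) ∘ f from rfl,
    ((hasDerivAt_inv hz).comp_hasFDerivAt z hf.hasFDerivAt).fderiv]
  simp
  ring

theorem pd_mul (hu : DifferentiableAt ℂ u z) (hv : DifferentiableAt ℂ v z) :
    pd l (fun w ↦ u w * v w) z = u z * pd l v z + v z * pd l u z := by
  simp only [pd]
  rw [fderiv_fun_mul hu hv]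
  simp

theorem pd_congr (huv : u =ᶠ[nhds z] v) : pd l u z = pd l v z := by
  simp only [pd, huv.fderiv_eq]

theorem Phi_congr {F' G' H' : (Fin m → ℂ) → ℂ} (hF : F =ᶠ[nhds z] F')
    (hG : G =ᶠ[nhds z] G') (hH : H =ᶠ[nhds z] H') : Phi l F G H z = Phi l F' G' H' z := by
  simp only [Phi, hF.eq_of_nhds, hG.eq_of_nhds, hH.eq_of_nhds, pd_congr hF.fun_inv,
    pd_congr hG.fun_inv, pd_congr hH.fun_inv]

theorem Phi_eq (hF : DifferentiableAt ℂ F z) (hG : DifferentiableAt ℂ G z)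
    (hH : DifferentiableAt ℂ H z) (hF0 : F z ≠ 0) (hG0 : G z ≠ 0) (hH0 : H z ≠ 0) :
    Phi l F G H z =
        F z * (H z * pd l G z - G z * pd l H z) / (G z * H z)
      + G z * (F z * pd l H z - H z * pd l F z) / (H z * F z)
      + H z * (G z * pd l F z - F z * pd l G z) / (F z * G z) := by
  rw [Phi, Matrix.det_fin_three, pd_inv hF hF0, pd_inv hG hG0, pd_inv hH hH0]
  simp
  field_simp
  ring

/-- Multiplying all three functions by `h` multiplies the Cartan auxiliary function by `h`. -/
theorem Phi_mul_left (hh : DifferentiableAt ℂ h z) (hu : DifferentiableAt ℂ u z)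
    (hv : DifferentiableAt ℂ v z) (hw : DifferentiableAt ℂ w z) (hh0 : h z ≠ 0)
    (hu0 : u z ≠ 0) (hv0 : v z ≠ 0) (hw0 : w z ≠ 0) :
    Phi l (fun x ↦ h x * u x) (fun x ↦ h x * v x) (fun x ↦ h x * w x) z =
      h z * Phi l u v w z := by
  rw [Phi_eq (hh.fun_mul hu) (hh.fun_mul hv) (hh.fun_mul hw) (mul_ne_zero hh0 hu0)
    (mul_ne_zero hh0 hv0) (mul_ne_zero hh0 hw0), Phi_eq hu hv hw hu0 hv0 hw0,
    pd_mul hh hu, pd_mul hh hv, pd_mul hh hw]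
  field_simp
  ring

end PartialDerivative

/-- If `F_i = h^{p₀}·u_i` with `u_i` nowhere vanishing holomorphic on an open set `U`,
then `Φ^1(F₁,F₂,F₃)` equals the displayed expression (carrying a factor `h^{p₀}`), and in
particular every zero of `h` is a zero of that expression of order at least `p₀`. -/
theorem phi_pow_factor {m : ℕ} (hm : 0 < m) (U : Set (Fin m → ℂ)) (hU : IsOpen U)
    (u₁ u₂ u₃ h : (Fin m → ℂ) → ℂ) (p₀ : ℕ) (hp₀ : 1 ≤ p₀)
    (hu₁ : ∀ z ∈ U, DifferentiableAt ℂ u₁ z) (hu₂ : ∀ z ∈ U, DifferentiableAt ℂ u₂ z)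
    (hu₃ : ∀ z ∈ U, DifferentiableAt ℂ u₃ z) (hh : ∀ z ∈ U, DifferentiableAt ℂ h z)
    (hu₁0 : ∀ z ∈ U, u₁ z ≠ 0) (hu₂0 : ∀ z ∈ U, u₂ z ≠ 0) (hu₃0 : ∀ z ∈ U, u₃ z ≠ 0)
    (F₁ F₂ F₃ : (Fin m → ℂ) → ℂ)
    (hF₁ : ∀ z ∈ U, F₁ z = h z ^ p₀ * u₁ z) (hF₂ : ∀ z ∈ U, F₂ z = h z ^ p₀ * u₂ z)
    (hF₃ : ∀ z ∈ U, F₃ z = h z ^ p₀ * u₃ z) :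
    (∀ z ∈ U, h z ≠ 0 →
      Phi ⟨0, hm⟩ F₁ F₂ F₃ z =
          u₁ z * ((u₃ z * pd ⟨0, hm⟩ u₂ z - u₂ z * pd ⟨0, hm⟩ u₃ z) * h z ^ p₀)
            / (u₂ z * u₃ z)
        + u₂ z * ((u₁ z * pd ⟨0, hm⟩ u₃ z - u₃ z * pd ⟨0, hm⟩ u₁ z) * h z ^ p₀)
            / (u₃ z * u₁ z)
        + u₃ z * ((u₂ z * pd ⟨0, hm⟩ u₁ z - u₁ z * pd ⟨0, hm⟩ u₂ z) * h z ^ p₀)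
            / (u₁ z * u₂ z)) ∧
    (∀ z ∈ U, h z = 0 → ∀ i < p₀,
      iteratedFDerivWithin ℂ i (fun w =>
          u₁ w * ((u₃ w * pd ⟨0, hm⟩ u₂ w - u₂ w * pd ⟨0, hm⟩ u₃ w) * h w ^ p₀)
            / (u₂ w * u₃ w)
        + u₂ w * ((u₁ w * pd ⟨0, hm⟩ u₃ w - u₃ w * pd ⟨0, hm⟩ u₁ w) * h w ^ p₀)
            / (u₃ w * u₁ w)
        + u₃ w * ((u₂ w * pd ⟨0, hm⟩ u₁ w - u₁ w * pd ⟨0, hm⟩ u₂ w) * h w ^ p₀)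
            / (u₁ w * u₂ w)) U z = 0) := by
  set l : Fin m := ⟨0, hm⟩
  refine ⟨fun z hz hz0 ↦ ?_, fun z hz hz0 i hi ↦ ?_⟩
  · have hU' := hU.mem_nhds hz
    rw [Phi_congr (Filter.eventuallyEq_of_mem hU' hF₁) (Filter.eventuallyEq_of_mem hU' hF₂)
      (Filter.eventuallyEq_of_mem hU' hF₃),
      Phi_mul_left ((hh z hz).fun_pow p₀) (hu₁ z hz) (hu₂ z hz) (hu₃ z hz) (pow_ne_zero _ hz0)
        (hu₁0 z hz) (hu₂0 z hz) (hu₃0 z hz),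
      Phi_eq (hu₁ z hz) (hu₂ z hz) (hu₃ z hz) (hu₁0 z hz) (hu₂0 z hz) (hu₃0 z hz)]
    ring
  · have smooth {u : (Fin m → ℂ) → ℂ} (hu : ∀ z ∈ U, DifferentiableAt ℂ u z) :
        ContDiffOn ℂ (⊤ : ℕ∞) u U ∧ ContDiffOn ℂ (⊤ : ℕ∞) (pd l u) U := by
      have hu' : DifferentiableOn ℂ u U := fun z hz ↦ (hu z hz).differentiableWithinAt
      exact ⟨hu'.contDiffOn_infty_of_isOpen hU,
        (hu'.fderiv_apply_of_isOpen hU _).contDiffOn_infty_of_isOpen hU⟩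
    have term {a b c d e : (Fin m → ℂ) → ℂ} (ha : ContDiffOn ℂ (⊤ : ℕ∞) a U)
        (hb : ContDiffOn ℂ (⊤ : ℕ∞) b U) (hc : ContDiffOn ℂ (⊤ : ℕ∞) c U)
        (hd : ContDiffOn ℂ (⊤ : ℕ∞) d U) (he : ContDiffOn ℂ (⊤ : ℕ∞) e U)
        (hb0 : ∀ z ∈ U, b z ≠ 0) (hd0 : ∀ z ∈ U, d z ≠ 0) :
        ContDiffOn ℂ (⊤ : ℕ∞) (fun w ↦ a w * (b w * c w - d w * e w) / (d w * b w)) U :=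
      (ha.mul ((hb.mul hc).sub (hd.mul he))).div (hd.mul hb)
        fun z hz ↦ mul_ne_zero (hd0 z hz) (hb0 z hz)
    obtain ⟨h₁, h₁'⟩ := smooth hu₁
    obtain ⟨h₂, h₂'⟩ := smooth hu₂
    obtain ⟨h₃, h₃'⟩ := smooth hu₃
    rw [← iteratedFDerivWithin_pow_mul_eq_zero hU.uniqueDiffOn (smooth hh).1
      (((term h₁ h₃ h₂' h₂ h₃' hu₃0 hu₂0).add (term h₂ h₁ h₃' h₃ h₁' hu₁0 hu₃0)).add
        (term h₃ h₂ h₁' h₁ h₂' hu₂0 hu₁0)) hz hz0 hi]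
    congr 1
    funext w
    ring
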